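/- For every odd prime p, the quadratic irrational Θ_p(t) ∈ F_p((t^{-1})) exhibits full generic escape of mass with respect to the sequence {t^k}_{k≥0}; that is, for every ε > 0, lim_{n→∞} d({k ∈ ℕ : e_{k,n}(Θ_p) > 1 − ε}) = 1. -/

import Mathlib

open scoped Classical
open Filter Polynomial

noncomputable section

namespace EscapeOfMass

variable {K : Type*} [Field K]

/-- The element `t` of `K((t⁻¹))`, modelled as the Laurent series field `K⸨X⸩`
in the variable `X = t⁻¹`; thus `t = X⁻¹ = single (-1) 1`. -/
def tLS (K : Type*) [Field K] : LaurentSeries K := HahnSeries.single (-1 : ℤ) 1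

/-- The polynomial part of a Laurent series in `K((t⁻¹))` (the terms with
non-negative powers of `t`, i.e. non-positive powers of `X`). -/
def polyPart (f : LaurentSeries K) : LaurentSeries K :=
  { coeff := fun n => if n ≤ 0 then f.coeff n else 0
    isPWO_support' := by
      refine f.isPWO_support'.mono fun n hn => ?_
      simp only [Function.mem_support, ne_eq] at hn ⊢
      intro h
      exact hn (by simp [h]) }

/-- The fractional part `⟨f⟩` of a Laurent series in `K((t⁻¹))`. -/
def fracPart (f : LaurentSeries K) : LaurentSeries K := f - polyPart f

/-- The complete quotients of the continued fraction expansion of `f`. -/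
def cfQuot (f : LaurentSeries K) : ℕ → LaurentSeries K
  | 0 => f
  | i + 1 => (cfQuot f i - polyPart (cfQuot f i))⁻¹

/-- The partial quotients `A_i` of the continued fraction expansion of `f`. -/
def cfPQ (f : LaurentSeries K) (i : ℕ) : LaurentSeries K := polyPart (cfQuot f i)

/-- The degree (as an integer) of a Laurent series viewed in `K((t⁻¹))`:
for a nonzero polynomial in `t` this is the usual degree. -/
def degZ (f : LaurentSeries K) : ℤ := -f.order

/-- `f` is a rational Laurent series, i.e. lies in `K(t)`. -/
def IsRatLS (f : LaurentSeries K) : Prop := ∃ r : RatFunc K, (r : LaurentSeries K) = f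

/-- `f` is a quadratic irrational: it is irrational and a root of a quadratic
polynomial with coefficients in `K[t]`. -/
def IsQuadIrr (f : LaurentSeries K) : Prop :=
  ¬ IsRatLS f ∧ ∃ a b c : Polynomial K, a ≠ 0 ∧
    Polynomial.aeval (tLS K) a * f ^ 2 + Polynomial.aeval (tLS K) b * f +
      Polynomial.aeval (tLS K) c = 0

/-- `(m, ℓ)` is a window for the periodic part of the continued fraction of `f`:
the partial quotients are periodic with period `ℓ ≥ 1` from index `m + 1` on. -/
def PeriodWindow (f : LaurentSeries K) (m ℓ : ℕ) : Prop :=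
  1 ≤ ℓ ∧ ∀ i : ℕ, m + 1 ≤ i → cfPQ f (i + ℓ) = cfPQ f i

/-- The `n`-escape of mass of the continued fraction expansion of `f`: the proportion,
within one period of the periodic part of the partial quotients of `f`, of the sum
`∑ max (deg A_i - n) 0` relative to `∑ deg A_i`. -/
def eMassOf (f : LaurentSeries K) (n : ℕ) : ℝ :=
  if h : ∃ s : ℕ × ℕ, PeriodWindow f s.1 s.2 then
    (∑ i ∈ Finset.Ico ((Classical.choose h).1 + 1)
        ((Classical.choose h).1 + 1 + (Classical.choose h).2),
        max ((degZ (cfPQ f i) : ℝ) - n) 0) /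
    (∑ i ∈ Finset.Ico ((Classical.choose h).1 + 1)
        ((Classical.choose h).1 + 1 + (Classical.choose h).2),
        (degZ (cfPQ f i) : ℝ))
  else 0

/-- The `n`-escape of mass in the `k`-th diagonal of `f` with respect to the
sequence `{g^k}`. -/
def eMassP (g f : LaurentSeries K) (k n : ℕ) : ℝ := eMassOf (g ^ k * f) n

/-- The `n`-escape of mass in the `k`-th diagonal of `f` with respect to `{t^k}`. -/
def eMass (f : LaurentSeries K) (k n : ℕ) : ℝ := eMassP (tLS K) f k n

/-- `f` exhibits `c` escape of mass with respect to the sequence `{g^k}`. -/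
def ExhibitsEscape (g f : LaurentSeries K) (c : ℝ) : Prop :=
  ∃ L : ℝ, Tendsto (fun n : ℕ => Filter.liminf (fun k : ℕ => eMassP g f k n) atTop)
    atTop (nhds L) ∧ c ≤ L

/-- `f` exhibits exactly `c` escape of mass with respect to the sequence `{g^k}`. -/
def ExhibitsExactEscape (g f : LaurentSeries K) (c : ℝ) : Prop :=
  Tendsto (fun n : ℕ => Filter.liminf (fun k : ℕ => eMassP g f k n) atTop)
    atTop (nhds c)

/-- `f` exhibits full (`c = 1`) maximal escape of mass with respect to `{g^k}`. -/
def ExhibitsFullMaxEscape (g f : LaurentSeries K) : Prop :=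
  Tendsto (fun n : ℕ => Filter.limsup (fun k : ℕ => eMassP g f k n) atTop)
    atTop (nhds 1)

/-- `A ⊆ ℕ` has natural density `c`. -/
def HasDensity (A : Set ℕ) (c : ℝ) : Prop :=
  Tendsto (fun M : ℕ => (((Finset.Icc 1 M).filter fun k => k ∈ A).card : ℝ) / M)
    atTop (nhds c)

/-- `f` exhibits full generic escape of mass with respect to `{t^k}`. -/
def FullGenericEscape (f : LaurentSeries K) : Prop :=
  ∀ ε : ℝ, 0 < ε → ∃ dens : ℕ → ℝ,
    (∀ n : ℕ, HasDensity {k : ℕ | 1 - ε < eMass f k n} (dens n)) ∧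
    Tendsto dens atTop (nhds 1)

/-- Substitution `t ↦ P(t)` on Laurent series: for `f = ∑_{i ≥ d} a_i t^{-i}` (with
`d = f.order` in the variable `X = t⁻¹`), `substLS f P = ∑_{i ≥ d} a_i P(t)^{-i}`. -/
def substLS (f : LaurentSeries K) (P : Polynomial K) : LaurentSeries K :=
  (Polynomial.aeval (tLS K) P)⁻¹ ^ f.order *
    HahnSeries.ofPowerSeries ℤ K
      (PowerSeries.mk fun n =>
        ∑ j ∈ Finset.range (n + 1),
          f.coeff (f.order + j) * (((Polynomial.aeval (tLS K) P)⁻¹ ^ j).coeff (n : ℤ)))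

/-- The `p`-Cantor sequence over `ZMod p`. -/
def cantor (p : ℕ) : ℕ → ZMod p
  | 0 => 1
  | (n + 1) =>
    if hp : 1 < p then
      if (n + 1) % p % 2 = 1 then 0
      else (((p - 1) / 2).choose (((n + 1) % p) / 2) : ZMod p) * cantor p ((n + 1) / p)
    else 0
  decreasing_by exact Nat.div_lt_self (Nat.succ_pos _) hp

/-- `Θ̃_p = ∑_{i ≥ 0} c_i^{(p)} t^{-i}`. -/
def cantorTilde (p : ℕ) : LaurentSeries (ZMod p) :=
  HahnSeries.ofPowerSeries ℤ (ZMod p) (PowerSeries.mk fun i => cantor p i)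

/-- `Θ_p = t⁻¹ ∑_{i ≥ 0} c_i^{(p)} t^{-i}`. -/
def cantorTheta (p : ℕ) : LaurentSeries (ZMod p) :=
  HahnSeries.single (1 : ℤ) 1 * cantorTilde p

/-- The Thue–Morse sequence over `ZMod 2`. -/
def thueMorse (n : ℕ) : ZMod 2 := ((Nat.digits 2 n).sum : ZMod 2)

/-- The Thue–Morse Laurent series `τ = ∑_{n ≥ 1} τ_n t^{-n}`. -/
def tmSeries : LaurentSeries (ZMod 2) :=
  HahnSeries.ofPowerSeries ℤ (ZMod 2) (PowerSeries.mk fun n => thueMorse n)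

/-- The extension of a one-sided sequence to `ℤ` by zero. -/
def extendSeq (S : ℕ → K) : ℤ → K := fun i => if 0 ≤ i then S i.toNat else 0

/-- The entry `W(S)[m, n]` of the number wall of the (doubly infinite) sequence `s`:
the determinant of the `(m+1) × (m+1)` Toeplitz matrix `(s_{n - i + j})`. -/
def wallEntry (s : ℤ → K) (m : ℕ) (n : ℤ) : K :=
  (Matrix.of fun i j : Fin (m + 1) => s (n - (i : ℕ) + (j : ℕ))).det

/-- The Laurent series `t⁻¹ ∑_{i ≥ 0} s_i t^{-i}` associated to a sequence. -/
def seriesOf (S : ℕ → K) : LaurentSeries K :=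
  HahnSeries.single (1 : ℤ) 1 * HahnSeries.ofPowerSeries ℤ K (PowerSeries.mk S)

/-- The coefficient sequence of `Θ = t⁻¹ ∑ s_i t^{-i}`, extended to `ℤ` by zero. -/
def coeffSeq (f : LaurentSeries K) : ℤ → K := fun i => if 0 ≤ i then f.coeff (i + 1) else 0

/-- The absolute value of a Laurent series in `F_q((t⁻¹))`: `|f| = q^{deg f}`. -/
def absLS {K : Type*} [Field K] [Fintype K] (f : LaurentSeries K) : ℝ :=
  if f = 0 then 0 else (Fintype.card K : ℝ) ^ (-f.order)


/-- polynomials in `t` as Laurent series -/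
def polyRing (K : Type*) [Field K] : Subalgebra K (LaurentSeries K) :=
  (Polynomial.aeval (tLS K)).range

lemma tLS_pow (i : ℕ) : (tLS K) ^ i = HahnSeries.single (-(i : ℤ)) 1 := by
  simp [tLS, HahnSeries.single_pow]

lemma coeff_aeval_t (P : K[X]) (n : ℤ) :
    (Polynomial.aeval (tLS K) P).coeff n = if n ≤ 0 then P.coeff (-n).toNat else 0 := by
  induction P using Polynomial.induction_on' with
  | add a b ha hb => rw [map_add, HahnSeries.coeff_add, ha, hb]; split_ifs <;> simp
  | monomial i a =>
    have h0 : (algebraMap K (LaurentSeries K)) a = HahnSeries.single 0 a := by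
      rw [← HahnSeries.C_apply, HahnSeries.algebraMap_apply', PowerSeries.algebraMap_apply,
        HahnSeries.ofPowerSeries_C]; rfl
    rw [Polynomial.aeval_monomial, tLS_pow, h0, HahnSeries.single_mul_single, mul_one, zero_add,
      HahnSeries.coeff_single, Polynomial.coeff_monomial]
    by_cases h : n = -(i : ℤ)
    · subst h; simp
    · rw [if_neg h]
      split_ifs with h1 h2
      · omega
      · simp
      · simp

lemma polyPart_coeff (f : LaurentSeries K) (n : ℤ) :
    (polyPart f).coeff n = if n ≤ 0 then f.coeff n else 0 := rfl

lemma polyPart_mem (f : LaurentSeries K) : polyPart f ∈ polyRing K := by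
  refine ⟨∑ i ∈ Finset.range ((-f.order).toNat + 1), Polynomial.monomial i (f.coeff (-(i : ℤ))), ?_⟩
  ext n
  change (Polynomial.aeval (tLS K) _).coeff n = _
  rw [coeff_aeval_t, polyPart_coeff]
  split_ifs with h
  · rw [Polynomial.finsetSum_coeff]
    simp only [Polynomial.coeff_monomial]
    rw [Finset.sum_ite_eq' (Finset.range ((-f.order).toNat + 1))]
    have : -((-n).toNat : ℤ) = n := by omega
    rw [this]
    split_ifs with h2
    · rfl
    · rw [HahnSeries.coeff_eq_zero_of_lt_order]
      simp only [Finset.mem_range] at h2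
      omega
  · rfl

lemma order_le_of_mem {f : LaurentSeries K} (hf : f ∈ polyRing K) (h0 : f ≠ 0) : f.order ≤ 0 := by
  obtain ⟨P, rfl⟩ := hf
  by_contra h
  apply h0
  rw [← HahnSeries.coeff_order_eq_zero]
  change (Polynomial.aeval (tLS K) P).coeff _ = 0
  rw [coeff_aeval_t, if_neg h]

lemma order_frac {f : LaurentSeries K} (h : f - polyPart f ≠ 0) : 0 < (f - polyPart f).order := by
  by_contra h1
  apply h
  rw [← HahnSeries.coeff_order_eq_zero]
  rw [HahnSeries.coeff_sub, polyPart_coeff, if_pos (not_lt.mp h1), sub_self]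

lemma order_polyPart {g : LaurentSeries K} (h : g.order < 0) :
    polyPart g ≠ 0 ∧ (polyPart g).order = g.order := by
  have hg : g ≠ 0 := by rintro rfl; simp at h
  have h1 : (polyPart g).coeff g.order ≠ 0 := by
    rw [polyPart_coeff, if_pos h.le]
    exact fun h2 => hg (HahnSeries.coeff_order_eq_zero.mp h2)
  have h2 : polyPart g ≠ 0 := by
    intro h3; rw [h3] at h1; simp at h1
  refine ⟨h2, le_antisymm (HahnSeries.order_le_of_coeff_ne_zero h1) ?_⟩
  rw [HahnSeries.le_order_iff_forall h2]
  intro j hj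
  rw [polyPart_coeff, HahnSeries.coeff_eq_zero_of_lt_order hj]; simp

lemma order_inv {f : LaurentSeries K} (h : f ≠ 0) : (f⁻¹).order = - f.order := by
  have := HahnSeries.order_mul h (inv_ne_zero h)
  rw [mul_inv_cancel₀ h, HahnSeries.order_one] at this
  omega

/-- the expansion does not terminate -/
def CFInf (f : LaurentSeries K) : Prop := ∀ i, cfQuot f i - polyPart (cfQuot f i) ≠ 0

lemma cfQuot_succ (f : LaurentSeries K) (i : ℕ) :
    cfQuot f (i+1) = (cfQuot f i - polyPart (cfQuot f i))⁻¹ := rfl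


lemma cfQuot_ne {f : LaurentSeries K} (hf : CFInf f) (i : ℕ) : cfQuot f (i+1) ≠ 0 := inv_ne_zero (hf i)

lemma cfQuot_order {f : LaurentSeries K} (hf : CFInf f) (i : ℕ) : (cfQuot f (i+1)).order < 0 := by
  rw [cfQuot_succ, order_inv (hf i)]
  have := order_frac (hf i)
  omega

lemma cfPQ_ne {f : LaurentSeries K} (hf : CFInf f) (i : ℕ) : cfPQ f (i+1) ≠ 0 := (order_polyPart (cfQuot_order hf i)).1

lemma cfPQ_order {f : LaurentSeries K} (hf : CFInf f) (i : ℕ) : (cfPQ f (i+1)).order = (cfQuot f (i+1)).order :=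
  (order_polyPart (cfQuot_order hf i)).2

lemma degZ_pos {f : LaurentSeries K} (hf : CFInf f) (i : ℕ) : 1 ≤ degZ (cfPQ f (i+1)) := by
  have := cfPQ_order hf i
  have := cfQuot_order hf i
  unfold degZ; omega

/-- denominators of convergents, shifted by one -/
def cfq (f : LaurentSeries K) : ℕ → LaurentSeries K
  | 0 => 0
  | 1 => 1
  | i + 2 => cfPQ f (i+1) * cfq f (i+1) + cfq f i

/-- numerators of convergents, shifted by one -/
def cfp (f : LaurentSeries K) : ℕ → LaurentSeries K
  | 0 => 1
  | 1 => cfPQ f 0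
  | i + 2 => cfPQ f (i+1) * cfp f (i+1) + cfp f i

/-- degree of the `i`-th convergent denominator -/
def cfN (f : LaurentSeries K) (i : ℕ) : ℤ := ∑ j ∈ Finset.range i, degZ (cfPQ f (j+1))

lemma cfN_succ (f : LaurentSeries K) (i : ℕ) : cfN f (i+1) = cfN f i + degZ (cfPQ f (i+1)) := by
  simp [cfN, Finset.sum_range_succ]

/-- approximation errors -/
def cfE (f : LaurentSeries K) (i : ℕ) : LaurentSeries K := cfq f i * f - cfp f i

lemma cfE_zero (f : LaurentSeries K) : cfE f 0 = -1 := by simp [cfE, cfq, cfp]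
lemma cfE_one (f : LaurentSeries K) : cfE f 1 = f - polyPart f := by
  simp [cfE, cfq, cfp, cfPQ, cfQuot]
lemma cfE_add_two (f : LaurentSeries K) (i : ℕ) :
    cfE f (i+2) = cfPQ f (i+1) * cfE f (i+1) + cfE f i := by
  simp only [cfE, cfq, cfp]; ring

lemma cfq_mem (f : LaurentSeries K) (i : ℕ) : cfq f i ∈ polyRing K ∧ cfq f (i+1) ∈ polyRing K := by
  induction i with
  | zero => exact ⟨zero_mem _, one_mem _⟩
  | succ i ih => exact ⟨ih.2, add_mem (mul_mem (polyPart_mem _) ih.2) ih.1⟩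

lemma cfp_mem (f : LaurentSeries K) (i : ℕ) : cfp f i ∈ polyRing K ∧ cfp f (i+1) ∈ polyRing K := by
  induction i with
  | zero => exact ⟨one_mem _, polyPart_mem _⟩
  | succ i ih => exact ⟨ih.2, add_mem (mul_mem (polyPart_mem _) ih.2) ih.1⟩

lemma cf_det (f : LaurentSeries K) (i : ℕ) :
    cfq f (i+1) * cfp f i - cfq f i * cfp f (i+1) = (-1) ^ i := by
  induction i with
  | zero => simp [cfq, cfp]
  | succ i ih =>
    rw [pow_succ, ← ih]
    simp only [cfq, cfp]; ring


lemma cfE_mul {f : LaurentSeries K} (hf : CFInf f) (i : ℕ) : cfE f (i+1) * cfQuot f (i+1) = - cfE f i := by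
  induction i with
  | zero =>
    rw [cfE_one, cfE_zero, cfQuot_succ]
    have := hf 0
    simp only [cfQuot] at this ⊢
    rw [mul_inv_cancel₀ this, neg_neg]
  | succ i ih =>
    have h := hf (i+1)
    rw [cfQuot_succ, cfE_add_two, ← div_eq_mul_inv, div_eq_iff h]
    have : cfE f i = - (cfE f (i+1) * cfQuot f (i+1)) := by rw [ih, neg_neg]
    rw [this, cfPQ]; ring

lemma cfE_ord {f : LaurentSeries K} (hf : CFInf f) (i : ℕ) : cfE f i ≠ 0 ∧ (cfE f i).order = cfN f i := by
  induction i with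
  | zero => rw [cfE_zero]; simp [cfN]
  | succ i ih =>
    have h := cfE_mul hf i
    have h0 : cfE f (i+1) ≠ 0 := by
      intro h1; rw [h1, zero_mul] at h
      exact ih.1 (by simpa using h.symm)
    refine ⟨h0, ?_⟩
    have h2 := congrArg HahnSeries.order h
    rw [HahnSeries.order_neg, HahnSeries.order_mul h0 (cfQuot_ne hf i), ih.2] at h2
    rw [cfN_succ, degZ, cfPQ_order hf]; omega

lemma cfN_lt {f : LaurentSeries K} (hf : CFInf f) (i : ℕ) : cfN f i < cfN f (i+1) := by
  have := degZ_pos hf i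
  rw [cfN_succ]; omega

lemma cfN_strictMono {f : LaurentSeries K} (hf : CFInf f) : StrictMono (cfN f) := strictMono_nat_of_lt_succ (cfN_lt hf)

lemma order_add_of_lt {x y : LaurentSeries K} (hx : x ≠ 0) (h : y = 0 ∨ x.order < y.order) :
    x + y ≠ 0 ∧ (x + y).order = x.order := by
  rcases h with rfl | h
  · simpa using hx
  have h1 : (x + y).coeff x.order ≠ 0 := by
    rw [HahnSeries.coeff_add, HahnSeries.coeff_eq_zero_of_lt_order h, add_zero]
    exact fun h2 => hx (HahnSeries.coeff_order_eq_zero.mp h2)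
  have h2 : x + y ≠ 0 := by
    intro h3; rw [h3] at h1; simp at h1
  refine ⟨h2, le_antisymm (HahnSeries.order_le_of_coeff_ne_zero h1) ?_⟩
  have := HahnSeries.min_order_le_order_add h2
  rwa [min_eq_left h.le] at this

lemma cfq_ord {f : LaurentSeries K} (hf : CFInf f) (i : ℕ) : cfq f (i+1) ≠ 0 ∧ (cfq f (i+1)).order = - cfN f i ∧
    (cfq f i = 0 ∨ -cfN f i < (cfq f i).order) := by
  induction i with
  | zero => simp [cfq, cfN]
  | succ i ih =>
    have hA := cfPQ_ne hf i
    have h1 := HahnSeries.order_mul hA ih.1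
    have hN := cfN_succ f i
    have hd := degZ_pos hf i
    have hl := order_add_of_lt (x := cfPQ f (i+1) * cfq f (i+1)) (y := cfq f i)
      (mul_ne_zero hA ih.1) (by
        rcases ih.2.2 with h | h
        · exact Or.inl h
        · right; rw [h1, ih.2.1]; unfold degZ at hd; omega)
    refine ⟨hl.1, ?_, ?_⟩
    · change (cfPQ f (i+1) * cfq f (i+1) + cfq f i).order = _
      rw [hl.2, h1, ih.2.1, hN, degZ]; omega
    · right; rw [ih.2.1]; omega

/-- A good rational approximation forces a gap among the convergent degrees. -/
lemma avoid {f : LaurentSeries K} (hf : CFInf f) {Q P : LaurentSeries K} (hQ : Q ∈ polyRing K) (hP : P ∈ polyRing K) (hQ0 : Q ≠ 0)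
    {a b : ℤ} (ha : 0 ≤ a) (hQa : -a ≤ Q.order)
    (hD : Q * f - P = 0 ∨ b ≤ (Q * f - P).order) (i : ℕ) (h1 : a < cfN f i) (h2 : cfN f i < b) :
    False := by
  obtain ⟨j, rfl⟩ : ∃ j, i = j + 1 := by
    cases i with
    | zero => simp [cfN] at h1; omega
    | succ j => exact ⟨j, rfl⟩
  have hE := cfE_ord hf (j+1)
  have hq := cfq_ord hf j
  have hlt := cfN_lt hf j
  -- u
  have hu_eq : Q * cfE f (j+1) - (Q * f - P) * cfq f (j+1) = P * cfq f (j+1) - Q * cfp f (j+1) := by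
    simp only [cfE]; ring
  have hu_mem : P * cfq f (j+1) - Q * cfp f (j+1) ∈ polyRing K :=
    sub_mem (mul_mem hP (cfq_mem f _).1) (mul_mem hQ (cfp_mem f _).1)
  have hu : P * cfq f (j+1) - Q * cfp f (j+1) = 0 := by
    by_contra hne
    have hle := order_le_of_mem hu_mem hne
    rw [← hu_eq] at hle hne
    have hx : 0 < (Q * cfE f (j+1)).order := by
      rw [HahnSeries.order_mul hQ0 hE.1, hE.2]; omega
    rcases hD with hD | hD
    · rw [hD, zero_mul, sub_zero] at hle; omega
    · by_cases hz : Q * f - P = 0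
      · rw [hz, zero_mul, sub_zero] at hle; omega
      have hy : 0 < (-((Q * f - P) * cfq f (j+1))).order := by
        rw [HahnSeries.order_neg, HahnSeries.order_mul hz hq.1, hq.2.1]; omega
      rw [sub_eq_add_neg] at hle hne
      have := HahnSeries.min_order_le_order_add hne
      have := lt_min hx hy
      omega
  set v := P * cfq f (j+2) - Q * cfp f (j+2) with hv
  have hv_mem : v ∈ polyRing K :=
    sub_mem (mul_mem hP (cfq_mem f _).1) (mul_mem hQ (cfp_mem f _).1)
  have hdet := cf_det f (j+1)
  have e1 : v * cfq f (j+1) = (-1)^(j+1) * Q := by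
    rw [← hdet, hv]; linear_combination cfq f (j+2) * hu
  have e2 : v * cfE f (j+1) = (-1)^(j+1) * (Q * f - P) := by
    simp only [cfE]
    have e3 : v * cfp f (j+1) = (-1)^(j+1) * P := by
      rw [← hdet, hv]; linear_combination cfp f (j+2) * hu
    linear_combination f * e1 - e3
  have hs : ((-1 : LaurentSeries K)^(j+1)) ≠ 0 := pow_ne_zero _ (by simp)
  have hso : ((-1 : LaurentSeries K)^(j+1)).order = 0 := by
    rw [HahnSeries.order_pow, HahnSeries.order_neg, HahnSeries.order_one, smul_zero]
  have hv0 : v ≠ 0 := by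
    intro h; rw [h, zero_mul] at e1
    exact mul_ne_zero hs hQ0 e1.symm
  have hD0 : Q * f - P ≠ 0 := by
    intro h; rw [h, mul_zero] at e2
    exact mul_ne_zero hv0 hE.1 e2
  have h3 := congrArg HahnSeries.order e2
  rw [HahnSeries.order_mul hv0 hE.1, HahnSeries.order_mul hs hD0, hso, hE.2] at h3
  have h4 := order_le_of_mem hv_mem hv0
  rcases hD with hD | hD
  · exact hD0 hD
  · omega

lemma cantor_rec (p : ℕ) [hp : Fact p.Prime] (n : ℕ) :
    cantor p n = (if (n % p) % 2 = 1 then 0 else (((p-1)/2).choose ((n % p)/2) : ZMod p)) *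
      cantor p (n / p) := by
  cases n with
  | zero => simp [cantor]
  | succ n =>
    conv_lhs => rw [cantor]
    rw [dif_pos hp.out.one_lt]
    split_ifs <;> simp

/-- the Cantor power series -/
def cantorPS (p : ℕ) : PowerSeries (ZMod p) := PowerSeries.mk fun i => cantor p i

/-- the multiplier -/
def multPS (p : ℕ) : PowerSeries (ZMod p) :=
  PowerSeries.expand 2 two_ne_zero (((1 + Polynomial.X) ^ ((p-1)/2) : (ZMod p)[X]) : PowerSeries (ZMod p))

lemma multPS_eq (p : ℕ) : multPS p = (1 + PowerSeries.X ^ 2) ^ ((p-1)/2) := by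
  simp [multPS]

lemma coeff_multPS (p n : ℕ) : (multPS p).coeff n =
    if n % 2 = 1 then 0 else (((p-1)/2).choose (n/2) : ZMod p) := by
  rw [multPS, PowerSeries.coeff_expand, Polynomial.coeff_coe, Polynomial.coeff_one_add_X_pow]
  by_cases h : n % 2 = 1
  · rw [if_pos h, if_neg (by omega)]
  · rw [if_neg h, if_pos (by omega)]

lemma expand_cantorPS (p : ℕ) [hp : Fact p.Prime] :
    PowerSeries.expand p hp.out.ne_zero (cantorPS p) = (cantorPS p) ^ p := by
  have h := MvPowerSeries.map_frobenius_expand p (f := cantorPS p) hp.out.ne_zero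
  rw [ZMod.frobenius_zmod, MvPowerSeries.map_id] at h
  exact h

lemma cantorPS_fun (p : ℕ) [hp : Fact p.Prime] (hodd : Odd p) :
    cantorPS p = multPS p * (cantorPS p) ^ p := by
  rw [← expand_cantorPS]
  ext n
  have hpp := hp.out.pos
  rw [PowerSeries.coeff_mul, Finset.sum_eq_single (n % p, p * (n / p))]
  · rw [PowerSeries.coeff_expand_mul, coeff_multPS, cantorPS, PowerSeries.coeff_mk,
      PowerSeries.coeff_mk]
    exact cantor_rec p n
  · rintro ⟨a, b⟩ hab hne
    rw [Finset.HasAntidiagonal.mem_antidiagonal] at hab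
    simp only at hab ⊢
    rw [coeff_multPS, PowerSeries.coeff_expand]
    by_cases hb : p ∣ b
    · obtain ⟨c, rfl⟩ := hb
      have ha : p ≤ a := by
        by_contra hlt
        push Not at hlt
        apply hne
        subst hab
        rw [Nat.add_mul_mod_self_left, Nat.mod_eq_of_lt hlt, Nat.add_mul_div_left _ _ hpp,
          Nat.div_eq_of_lt hlt, zero_add]
      split_ifs with h1 h2 <;> try simp
      rw [Nat.choose_eq_zero_of_lt (by omega)]; simp
    · rw [if_neg hb, mul_zero]
  · intro h
    exfalso; apply h
    rw [Finset.HasAntidiagonal.mem_antidiagonal]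
    exact Nat.mod_add_div n p

lemma cantorPS_sq (p : ℕ) [hp : Fact p.Prime] (hodd : Odd p) :
    (1 + PowerSeries.X ^ 2) * (cantorPS p) ^ 2 = 1 := by
  have h1 := cantorPS_fun p hodd
  have hc : PowerSeries.constantCoeff (cantorPS p) = 1 := by
    rw [← PowerSeries.coeff_zero_eq_constantCoeff_apply, cantorPS, PowerSeries.coeff_mk, cantor]
  have hne : cantorPS p ≠ 0 := by
    intro h; rw [h] at hc; simp at hc
  obtain ⟨s, hs⟩ := hodd
  have hs2 : (p - 1) / 2 = s := by omega
  set G := (1 + PowerSeries.X ^ 2) * (cantorPS p) ^ 2 with hG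
  have hGs : G ^ s = 1 := by
    have : cantorPS p * 1 = cantorPS p * G ^ s := by
      rw [mul_one]
      conv_lhs => rw [h1, multPS_eq, hs2]
      rw [hG, mul_pow, ← pow_mul]
      have h3 : cantorPS p ^ p = cantorPS p * cantorPS p ^ (2 * s) := by
        rw [← pow_succ']; exact congrArg (fun e => cantorPS p ^ e) hs
      rw [h3]; ring
    exact (mul_left_cancel₀ hne this).symm
  have hgeom := mul_geom_sum G s
  rw [hGs, sub_self] at hgeom
  rcases mul_eq_zero.mp hgeom with h | h
  · exact sub_eq_zero.mp h
  · exfalso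
    have h2 := congrArg PowerSeries.constantCoeff h
    have hG1 : PowerSeries.constantCoeff G = 1 := by simp [hG, hc]
    simp only [map_sum, map_pow, hG1, one_pow, Finset.sum_const, Finset.card_range, map_zero,
      nsmul_eq_mul, mul_one] at h2
    rw [ZMod.natCast_eq_zero_iff] at h2
    have := Nat.le_of_dvd (by have := hp.out.two_le; omega) h2
    omega

/-- `t^2+1` -/
def DD (K : Type*) [Field K] : LaurentSeries K := tLS K ^ 2 + 1

lemma theta_sq (p : ℕ) [hp : Fact p.Prime] (hodd : Odd p) :
    DD (ZMod p) * cantorTheta p ^ 2 = 1 := by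
  have h := congrArg (HahnSeries.ofPowerSeries ℤ (ZMod p)) (cantorPS_sq p hodd)
  simp only [map_mul, map_add, map_one, map_pow, HahnSeries.ofPowerSeries_X] at h
  have ht : tLS (ZMod p) * HahnSeries.single (1:ℤ) 1 = 1 := by
    simp [tLS]
  rw [DD, cantorTheta]
  change (_ : LaurentSeries (ZMod p)) * (_ * HahnSeries.ofPowerSeries ℤ (ZMod p) (cantorPS p))^2 = 1
  linear_combination ((tLS (ZMod p) * HahnSeries.single (1:ℤ) 1) + 1) *
    (HahnSeries.ofPowerSeries ℤ (ZMod p) (cantorPS p))^2 * ht + h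

lemma tLS_ne : tLS K ≠ 0 := by simp [tLS]

lemma tLS_order : (tLS K).order = -1 := by simp [tLS]

lemma tLS_mem : tLS K ∈ polyRing K := ⟨Polynomial.X, by simp⟩

lemma DD_mem : DD K ∈ polyRing K := add_mem (pow_mem tLS_mem _) (one_mem _)

lemma DD_ord : DD K ≠ 0 ∧ (DD K).order = -2 := by
  have h := order_add_of_lt (x := tLS K ^ 2) (y := 1) (pow_ne_zero _ tLS_ne)
    (Or.inr (by rw [HahnSeries.order_pow, tLS_order, HahnSeries.order_one]; norm_num))
  refine ⟨h.1, h.2.trans ?_⟩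
  rw [HahnSeries.order_pow, tLS_order]; norm_num

/-- the multiples `t^k Θ` -/
def al (p k : ℕ) [Fact p.Prime] : LaurentSeries (ZMod p) := tLS (ZMod p) ^ k * cantorTheta p

/-- vanishing of order at least `n` -/
def Vb (x : LaurentSeries K) (n : ℤ) : Prop := x = 0 ∨ n ≤ x.order

lemma Vb.mul {x y : LaurentSeries K} {a b : ℤ} (hx : Vb x a) (hy : Vb y b) : Vb (x*y) (a+b) := by
  by_cases h1 : x = 0
  · left; simp [h1]
  by_cases h2 : y = 0
  · left; simp [h2]
  right
  rw [HahnSeries.order_mul h1 h2]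
  exact add_le_add (hx.resolve_left h1) (hy.resolve_left h2)

lemma Vb.add {x y : LaurentSeries K} {a : ℤ} (hx : Vb x a) (hy : Vb y a) : Vb (x+y) a := by
  by_cases h1 : x = 0
  · simpa [h1] using hy
  by_cases h2 : y = 0
  · simpa [h2] using hx
  by_cases h3 : x + y = 0
  · exact Or.inl h3
  right
  have := HahnSeries.min_order_le_order_add h3
  have := le_min (hx.resolve_left h1) (hy.resolve_left h2)
  omega

lemma Vb.neg {x : LaurentSeries K} {a : ℤ} (hx : Vb x a) : Vb (-x) a := by
  rcases hx with h | h
  · left; simp [h]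
  · right; rwa [HahnSeries.order_neg]

lemma Vb.sub {x y : LaurentSeries K} {a : ℤ} (hx : Vb x a) (hy : Vb y a) : Vb (x-y) a := by
  rw [sub_eq_add_neg]; exact hx.add hy.neg

lemma Vb.mono {x : LaurentSeries K} {a b : ℤ} (hx : Vb x a) (h : b ≤ a) : Vb x b := by
  rcases hx with h1 | h1
  · exact Or.inl h1
  · exact Or.inr (h.trans h1)

lemma Vb.of_order {x : LaurentSeries K} {a : ℤ} (h : x.order = a) : Vb x a := Or.inr h.ge

lemma Vb.of_coeff {x : LaurentSeries K} {a : ℤ} (h : ∀ n < a, x.coeff n = 0) : Vb x a := by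
  by_cases h1 : x = 0
  · exact Or.inl h1
  · right; rwa [HahnSeries.le_order_iff_forall h1]

lemma Vb.coeff {x : LaurentSeries K} {a : ℤ} (hx : Vb x a) {n : ℤ} (h : n < a) : x.coeff n = 0 := by
  rcases hx with h1 | h1
  · simp [h1]
  · exact HahnSeries.coeff_eq_zero_of_lt_order (h.trans_le h1)

lemma Vb.pow {x : LaurentSeries K} {a : ℤ} (hx : Vb x a) (n : ℕ) : Vb (x^n) (n * a) := by
  induction n with
  | zero => exact Vb.of_order (by simp)
  | succ n ih =>
    rw [pow_succ]
    exact (ih.mul hx).mono (by push_cast; linarith)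

/-- irrationality -/
def Irr (f : LaurentSeries K) : Prop :=
  ∀ Q ∈ polyRing K, ∀ P ∈ polyRing K, Q ≠ 0 → Q * f ≠ P

lemma Irr.frac {f : LaurentSeries K} (h : Irr f) : f - polyPart f ≠ 0 := by
  intro h1
  exact h 1 (one_mem _) _ (polyPart_mem f) one_ne_zero (by rw [one_mul]; exact sub_eq_zero.mp h1)

lemma Irr.next {f : LaurentSeries K} (h : Irr f) : Irr (f - polyPart f)⁻¹ := by
  intro Q hQ P hP hQ0 he
  have hx := h.frac
  have h2 : P * (f - polyPart f) = Q := by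
    rw [← he, mul_assoc, inv_mul_cancel₀ hx, mul_one]
  have hP0 : P ≠ 0 := by
    rintro rfl; rw [zero_mul] at h2; exact hQ0 h2.symm
  exact h P hP (Q + P * polyPart f) (add_mem hQ (mul_mem hP (polyPart_mem f))) hP0
    (by rw [← h2]; ring)

lemma Irr.cfInf {f : LaurentSeries K} (h : Irr f) : CFInf f := by
  have : ∀ i, Irr (cfQuot f i) := by
    intro i
    induction i with
    | zero => exact h
    | succ i ih => exact ih.next
  exact fun i => (this i).frac

lemma aeval_t_injective : Function.Injective (Polynomial.aeval (R := K) (tLS K)) := by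
  intro P Q h
  ext i
  have h1 := congrArg (fun x : LaurentSeries K => x.coeff (-(i:ℤ))) h
  simpa [coeff_aeval_t] using h1

lemma irr_of_sq (h2 : (2 : K) ≠ 0) {f : LaurentSeries K} {k : ℕ}
    (hf : DD K * f ^ 2 = tLS K ^ (2*k)) : Irr f := by
  rintro _ ⟨Q, rfl⟩ _ ⟨P, rfl⟩ hQ0 he
  change Polynomial.aeval (tLS K) Q ≠ 0 at hQ0
  change Polynomial.aeval (tLS K) Q * f = Polynomial.aeval (tLS K) P at he
  have h3 : (Polynomial.X ^ 2 + 1) * P ^ 2 = (Polynomial.X ^ k * Q) ^ 2 := by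
    apply aeval_t_injective
    simp only [map_mul, map_add, map_pow, Polynomial.aeval_X, map_one]
    rw [← he]
    rw [DD] at hf
    linear_combination (Polynomial.aeval (tLS K) Q)^2 * hf
  have hP0 : P ≠ 0 := by
    rintro rfl
    rw [map_zero] at he
    rcases mul_eq_zero.mp he with h | h
    · exact hQ0 h
    · rw [h, zero_pow two_ne_zero, mul_zero] at hf; exact pow_ne_zero _ tLS_ne hf.symm
  have h4 : P ∣ Polynomial.X ^ k * Q := by
    rw [← IsIntegrallyClosed.pow_dvd_pow_iff (two_ne_zero), ← h3]
    exact dvd_mul_left _ _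
  obtain ⟨S, hS⟩ := h4
  have h5 : (Polynomial.X ^ 2 + 1 : K[X]) = S ^ 2 := by
    rw [hS, mul_pow, mul_comm] at h3
    exact mul_left_cancel₀ (pow_ne_zero _ hP0) h3
  have h6 := congrArg Polynomial.derivative h5
  simp only [Polynomial.derivative_add, Polynomial.derivative_one,
    Polynomial.derivative_pow] at h6
  have h7 : (Polynomial.X : K[X]) = S * Polynomial.derivative S := by
    have h8 : (Polynomial.C (2:K)) ≠ 0 := by simpa using h2
    apply mul_left_cancel₀ h8
    simp only [Polynomial.derivative_X, add_zero, mul_one, Nat.add_one_sub_one, pow_one] at h6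
    rw [← mul_assoc]; exact_mod_cast h6
  have h9 : (Polynomial.X ^ 2 + 1 : K[X]) ∣ Polynomial.X ^ 2 := by
    rw [h5]; exact pow_dvd_pow_of_dvd (Dvd.intro _ h7.symm) 2
  have h10 : (Polynomial.X ^ 2 + 1 : K[X]) ∣ 1 := by
    have := dvd_sub (dvd_refl (Polynomial.X ^ 2 + 1 : K[X])) h9
    simpa using this
  have h11 := Polynomial.natDegree_eq_zero_of_isUnit (isUnit_of_dvd_one h10)
  have h12 : (Polynomial.X ^ 2 + 1 : K[X]).natDegree = 2 := by compute_degree!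
  omega

lemma finite_poly [Finite K] (c : ℤ) : {x : LaurentSeries K | x ∈ polyRing K ∧ Vb x (-c)}.Finite := by
  refine Set.Finite.of_injOn (f := fun x : LaurentSeries K => fun i : Fin (c.toNat+1) => x.coeff (-(i:ℤ)))
    (t := Set.univ) (fun _ _ => Set.mem_univ _) ?_ Set.finite_univ
  rintro _ ⟨⟨x, rfl⟩, hxV⟩ _ ⟨⟨y, rfl⟩, hyV⟩ he
  ext n
  by_cases h1 : n < -c
  · rw [hxV.coeff h1, hyV.coeff h1]
  by_cases h2 : n ≤ 0
  · have := congrFun he ⟨(-n).toNat, by omega⟩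
    simp only at this
    have h3 : -(((-n).toNat : ℕ) : ℤ) = n := by omega
    rwa [h3] at this
  · change (Polynomial.aeval (tLS K) x).coeff n = (Polynomial.aeval (tLS K) y).coeff n
    rw [coeff_aeval_t, coeff_aeval_t, if_neg h2, if_neg h2]

/-- Lagrange: eventual periodicity. -/
lemma exists_window [Finite K] {f B : LaurentSeries K} (hirr : Irr f) (hB : B ∈ polyRing K)
    (hf : DD K * f ^ 2 = B) : ∃ s : ℕ × ℕ, PeriodWindow f s.1 s.2 := by
  have hI := hirr.cfInf
  set c : ℤ := 2 + |f.order| with hc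
  have hfin := finite_poly (K := K) c
  set F := {x : LaurentSeries K | x ∈ polyRing K ∧ Vb x (-c)} with hF
  have hfo : -|f.order| ≤ f.order := neg_abs_le _
  have habs := abs_nonneg f.order
  have hDD := Vb.of_order (DD_ord (K := K)).2
  have key : ∀ j, cfQuot f (j+1) ∈ (fun y : LaurentSeries K × LaurentSeries K × LaurentSeries K =>
      (y.1 + y.2.2 * (DD K * f)) / y.2.1) '' (F ×ˢ (F ×ˢ ({1, -1} : Set (LaurentSeries K)))) := by
    intro j
    set E' := -(cfq f (j+1) * f) - cfp f (j+1) with hE'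
    have hq := cfq_ord hI j
    have hE'0 : E' ≠ 0 := by
      intro h
      exact hirr _ (cfq_mem f j).2 (-(cfp f (j+1))) (neg_mem (cfp_mem f j).2) hq.1
        (by linear_combination -h)
    have hE1 := cfE_ord hI (j+1)
    have hE := cfE_ord hI j
    have hlt := cfN_lt hI j
    have hNn : 0 ≤ cfN f j := by
      have := (cfN_strictMono hI).monotone (Nat.zero_le j)
      simpa [cfN] using this
    have hqf : Vb (cfq f (j+1) * f) (-cfN f j - |f.order|) :=
      ((Vb.of_order hq.2.1).mul (Or.inr hfo : Vb f _)).mono (by omega)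
    have hVE' : Vb E' (-cfN f j - |f.order|) := by
      have : E' = cfE f (j+1) - cfq f (j+1) * f - cfq f (j+1) * f := by
        rw [hE', cfE]; ring
      rw [this]
      exact (((Vb.of_order hE1.2).mono (by omega)).sub hqf).sub hqf
    set Cj := DD K * cfE f (j+1) * E' with hCj
    set Bj := B * (cfq f j * cfq f (j+1)) - DD K * (cfp f j * cfp f (j+1)) with hBj
    have hdet := cf_det f j
    have hBE : Bj = -(DD K * cfE f j * E') - -((-1)^j) * (DD K * f) := by
      rw [hBj, hE', cfE, ← hf, ← hdet]; ring
    have hs : -((-1 : LaurentSeries K)^j) = 1 ∨ -((-1 : LaurentSeries K)^j) = -1 := by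
      rcases neg_one_pow_eq_or (LaurentSeries K) j with h | h <;> simp [h]
    have hCx : Cj * cfQuot f (j+1) = Bj + -((-1)^j) * (DD K * f) := by
      rw [hBE, hCj]
      linear_combination DD K * E' * cfE_mul hI j
    have hC0 : Cj ≠ 0 := mul_ne_zero (mul_ne_zero DD_ord.1 hE1.1) hE'0
    refine ⟨(Bj, Cj, -((-1)^j)), ⟨⟨?_, ?_⟩, ⟨?_, ?_⟩, ?_⟩, ?_⟩
    · exact sub_mem (mul_mem hB (mul_mem (cfq_mem f j).1 (cfq_mem f j).2))
        (mul_mem DD_mem (mul_mem (cfp_mem f j).1 (cfp_mem f j).2))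
    · simp only
      rw [hBE]
      refine Vb.sub (Vb.neg ?_) ?_
      · exact ((hDD.mul (Vb.of_order hE.2)).mul hVE').mono (by omega)
      · have h1 : Vb (DD K * f) (-c) := (hDD.mul (Or.inr hfo : Vb f _)).mono (by omega)
        rcases hs with h | h <;> rw [h]
        · rwa [one_mul]
        · rw [neg_one_mul]; exact h1.neg
    · have : Cj = DD K * (cfp f (j+1) * cfp f (j+1)) - B * (cfq f (j+1) * cfq f (j+1)) := by
        rw [hCj, hE', cfE, ← hf]; ring
      simp only
      rw [this]
      exact sub_mem (mul_mem DD_mem (mul_mem (cfp_mem f j).2 (cfp_mem f j).2))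
        (mul_mem hB (mul_mem (cfq_mem f j).2 (cfq_mem f j).2))
    · exact ((hDD.mul (Vb.of_order hE1.2)).mul hVE').mono (by omega)
    · exact hs
    · simp only
      rw [← hCx, mul_div_cancel_left₀ _ hC0]
  have hfin2 : ((fun y : LaurentSeries K × LaurentSeries K × LaurentSeries K =>
      (y.1 + y.2.2 * (DD K * f)) / y.2.1) '' (F ×ˢ (F ×ˢ ({1, -1} : Set (LaurentSeries K))))).Finite :=
    (hfin.prod (hfin.prod (Set.toFinite _))).image _
  obtain ⟨i, -, j, -, hij, he⟩ := Set.infinite_univ.exists_lt_map_eq_of_mapsTo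
    (f := fun j : ℕ => cfQuot f (j+1)) (fun j _ => key j) hfin2
  refine ⟨(i, j - i), by simp only; omega, ?_⟩
  intro n hn
  have : cfQuot f (n + (j-i)) = cfQuot f n := by
    induction n, hn using Nat.le_induction with
    | base =>
      have h : i + 1 + (j - i) = j + 1 := by omega
      rw [h]; exact he.symm
    | succ n _ ih =>
      have h : n + 1 + (j - i) = (n + (j-i)) + 1 := by omega
      rw [h, cfQuot_succ, ih, ← cfQuot_succ]
  simp only [cfPQ]; rw [this]

lemma cantor_odd (p : ℕ) [hp : Fact p.Prime] (hodd : Odd p) (n : ℕ) (hn : n % 2 = 1) :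
    cantor p n = 0 := by
  induction n using Nat.strong_induction_on with
  | _ n ih =>
    rw [cantor_rec]
    by_cases h : (n % p) % 2 = 1
    · rw [if_pos h, zero_mul]
    · rw [ih (n / p) (Nat.div_lt_self (by omega) hp.out.one_lt), mul_zero]
      have h1 := Nat.mod_add_div n p
      have h2 : (p * (n/p)) % 2 = 1 := by omega
      rw [Nat.mul_mod] at h2
      have h3 : p % 2 = 1 := Nat.odd_iff.mp hodd
      rw [h3] at h2; omega

lemma al_coeff (p k : ℕ) [hp : Fact p.Prime] (hodd : Odd p) (hk : k % 2 = 1) (n : ℤ) (hn : n % 2 = 1) :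
    (al p k).coeff n = 0 := by
  rw [al, tLS_pow, cantorTheta, ← mul_assoc, HahnSeries.single_mul_single, HahnSeries.coeff_single_mul,
    cantorTilde, one_mul, one_mul]
  by_cases h : 0 ≤ n - (-(k:ℤ) + 1)
  · obtain ⟨m, hm⟩ := Int.eq_ofNat_of_zero_le h
    rw [hm, HahnSeries.ofPowerSeries_apply_coeff, PowerSeries.coeff_mk]
    exact cantor_odd p hodd m (by omega)
  · rw [HahnSeries.ofPowerSeries_apply]
    apply HahnSeries.embDomain_of_notMem_range
    rintro ⟨m, hm⟩
    simp at hm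
    omega

lemma aeval_mul_coeff (G : K[X]) (x : LaurentSeries K) (n : ℤ) :
    (Polynomial.aeval (tLS K) G * x).coeff n = G.sum fun i a => a * x.coeff (n + i) := by
  induction G using Polynomial.induction_on' with
  | add a b ha hb =>
    rw [map_add, add_mul, HahnSeries.coeff_add, ha, hb, Polynomial.sum_add_index] <;> simp [add_mul]
  | monomial i a =>
    have h0 : (algebraMap K (LaurentSeries K)) a = HahnSeries.single 0 a := by
      rw [← HahnSeries.C_apply, HahnSeries.algebraMap_apply', PowerSeries.algebraMap_apply,
        HahnSeries.ofPowerSeries_C]; rfl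
    rw [Polynomial.aeval_monomial, tLS_pow, h0, HahnSeries.single_mul_single, mul_one, zero_add,
      HahnSeries.coeff_single_mul, Polynomial.sum_monomial_index _ _ (by simp), sub_neg_eq_add]

/-- approximations of odd diagonals -/
lemma approx_odd (p k : ℕ) [hp : Fact p.Prime] (hodd : Odd p) (hk : k % 2 = 1) (m : ℕ) :
    ∃ Q ∈ polyRing (ZMod p), ∃ P ∈ polyRing (ZMod p), Q ≠ 0 ∧ Vb Q (-(2*m)) ∧
      Vb (Q * al p k - P) (2*m+2) := by
  let φ : (Fin (m+1) → ZMod p) →ₗ[ZMod p] (Fin m → ZMod p) :=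
    { toFun := fun g j => ∑ i, g i * (al p k).coeff (2 * ((j:ℕ):ℤ) + 2 + 2 * ((i:ℕ):ℤ))
      map_add' := by
        intro g h; ext j; simp [add_mul, Finset.sum_add_distrib]
      map_smul' := by
        intro c g; ext j; simp [Finset.mul_sum, mul_assoc] }
  have hker : LinearMap.ker φ ≠ ⊥ := LinearMap.ker_ne_bot_of_finrank_lt (by simp)
  obtain ⟨g, hg, hg0⟩ := (Submodule.ne_bot_iff _).mp hker
  rw [LinearMap.mem_ker] at hg
  let G : (ZMod p)[X] := ∑ i : Fin (m+1), Polynomial.monomial (2 * (i:ℕ)) (g i)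
  have hGc : ∀ n, G.coeff n = ∑ i : Fin (m+1), if 2 * (i:ℕ) = n then g i else 0 := by
    intro n
    simp only [G, Polynomial.finsetSum_coeff, Polynomial.coeff_monomial]
  have hmul : ∀ n, (Polynomial.aeval (tLS (ZMod p)) G * al p k).coeff n =
      ∑ i : Fin (m+1), g i * (al p k).coeff (n + 2 * ((i:ℕ):ℤ)) := by
    intro n
    simp only [G, map_sum, Finset.sum_mul, HahnSeries.coeff_sum]
    refine Finset.sum_congr rfl fun i _ => ?_
    rw [aeval_mul_coeff, Polynomial.sum_monomial_index _ _ (by simp)]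
    push_cast; rfl
  refine ⟨Polynomial.aeval (tLS (ZMod p)) G, ⟨G, rfl⟩, polyPart (Polynomial.aeval (tLS (ZMod p)) G * al p k),
    polyPart_mem _, ?_, ?_, ?_⟩
  · intro h
    apply hg0
    have hG0 : G = 0 := aeval_t_injective (by rw [h, map_zero])
    ext i
    have h2 := hGc (2 * (i:ℕ))
    rw [hG0, Finset.sum_eq_single i] at h2
    · simpa using h2.symm
    · intro j _ hj
      rw [if_neg]
      intro h3; apply hj; ext; omega
    · simp
  · apply Vb.of_coeff
    intro n hn
    rw [coeff_aeval_t, hGc]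
    split_ifs
    · apply Finset.sum_eq_zero
      intro i _
      have := i.2
      rw [if_neg]; omega
    · rfl
  · apply Vb.of_coeff
    intro n hn
    rw [HahnSeries.coeff_sub, polyPart_coeff]
    split_ifs with h
    · simp
    · rw [sub_zero, hmul]
      by_cases hn2 : n % 2 = 1
      · apply Finset.sum_eq_zero
        intro i _
        rw [al_coeff p k hodd hk _ (by omega), mul_zero]
      · have h3 := congrFun hg ⟨((n-2)/2).toNat, by omega⟩
        simp only [φ, LinearMap.coe_mk, AddHom.coe_mk, Pi.zero_apply] at h3
        have h4 : 2 * ((((n-2)/2).toNat : ℕ) : ℤ) + 2 = n := by omega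
        rw [h4] at h3
        exact h3

lemma al_sq (p k : ℕ) [hp : Fact p.Prime] (hodd : Odd p) :
    DD (ZMod p) * al p k ^ 2 = tLS (ZMod p) ^ (2 * k) := by
  rw [al]
  linear_combination tLS (ZMod p) ^ (2 * k) * theta_sq p hodd

lemma al_irr (p k : ℕ) [hp : Fact p.Prime] (hodd : Odd p) : Irr (al p k) := by
  refine irr_of_sq ?_ (al_sq p k hodd)
  have h : ((2:ℕ) : ZMod p) ≠ 0 := by
    rw [Ne, ZMod.natCast_eq_zero_iff]
    intro h
    have := Nat.le_of_dvd (by norm_num) h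
    have := hp.out.two_le
    have : p = 2 := by omega
    subst this
    exact absurd hodd (by decide)
  exact_mod_cast h

lemma charP_LS (p : ℕ) [hp : Fact p.Prime] : CharP (LaurentSeries (ZMod p)) p :=
  charP_of_injective_algebraMap (algebraMap (ZMod p) (LaurentSeries (ZMod p))).injective p

lemma theta_frob (p e : ℕ) [hp : Fact p.Prime] (hodd : Odd p) :
    cantorTheta p = DD (ZMod p) ^ ((p^e - 1)/2) * cantorTheta p ^ (p^e) := by
  obtain ⟨s, hs⟩ := hodd.pow (n := e)
  have h : (p^e-1)/2 = s := by omega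
  rw [h]
  have h2 : cantorTheta p ^ (p^e) = cantorTheta p ^ (2*s+1) := congrArg (fun n => cantorTheta p ^ n) hs
  have h3 : DD (ZMod p) ^ s * cantorTheta p ^ (2*s+1) = (DD (ZMod p) * cantorTheta p ^ 2)^s * cantorTheta p := by
    rw [mul_pow]; ring
  rw [h2, h3, theta_sq p hodd]; simp

lemma approx_scaled (p k e r : ℕ) [hp : Fact p.Prime] (hodd : Odd p) (hk : k % 2 = 1) (m : ℕ) :
    ∃ Q ∈ polyRing (ZMod p), ∃ P ∈ polyRing (ZMod p), Q ≠ 0 ∧ Vb Q (-(2*m*p^e)) ∧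
      Vb (Q * al p (k * p^e + r) - P) ((2*m+1) * p^e - r + 1) := by
  obtain ⟨Q, hQ, P, hP, hQ0, hQV, hD⟩ := approx_odd p k hodd hk m
  have := charP_LS p
  set E := tLS (ZMod p) ^ r * DD (ZMod p) ^ ((p^e - 1)/2) with hE
  have hEm : E ∈ polyRing (ZMod p) := mul_mem (pow_mem tLS_mem _) (pow_mem DD_mem _)
  have hodd2 := Nat.odd_iff.mp (hodd.pow (n := e))
  refine ⟨Q ^ (p^e), pow_mem hQ _, E * P ^ (p^e), mul_mem hEm (pow_mem hP _), pow_ne_zero _ hQ0, ?_, ?_⟩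
  · refine (hQV.pow (p^e)).mono ?_
    push_cast; ring_nf; rfl
  · have h1 : Q ^ (p^e) * al p (k * p^e + r) - E * P ^ (p^e) = E * (Q * al p k - P) ^ (p^e) := by
      rw [sub_pow_char_pow (p := p), mul_pow, al, al]
      conv_lhs => rw [theta_frob p e hodd]
      rw [hE]; ring
    rw [h1]
    have hEV : Vb E (-r - (p^e - 1)) := by
      refine (((Vb.of_order tLS_order).pow r).mul ((Vb.of_order DD_ord.2).pow _)).mono ?_
      have h2 : (((p^e-1)/2 : ℕ) : ℤ) * 2 = (p:ℤ)^e - 1 := by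
        have : ((p^e : ℕ) : ℤ) = (p:ℤ)^e := by push_cast; rfl
        rw [← this]; omega
      linarith
    refine (hEV.mul (hD.pow _)).mono ?_
    push_cast; ring_nf; rfl

/-- set of degrees of convergents of `t^k Θ` -/
def SS (p : ℕ) [Fact p.Prime] (k M : ℕ) : Prop := ∃ i, cfN (al p k) i = M

lemma SS_avoid (p : ℕ) [hp : Fact p.Prime] (hodd : Odd p) (e k n r s : ℕ) (hk : k % 2 = 1)
    (hn : n % 2 = 0) (hr : r < p^e) (hs1 : p^e ≤ s) (hs2 : s < 2 * p^e) :
    ¬ SS p (k * (p^e * p) + r) (n * (p^e * p) + s) := by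
  rintro ⟨i, hi⟩
  obtain ⟨m, rfl⟩ : ∃ m, n = 2 * m := ⟨n/2, by omega⟩
  rw [← pow_succ] at hi
  obtain ⟨Q, hQ, P, hP, hQ0, hQV, hD⟩ := approx_scaled p k (e+1) r hodd hk m
  have hp3 : 3 ≤ p := by
    have := hp.out.two_le
    rcases Nat.lt_or_ge p 3 with h | h
    · have : p = 2 := by omega
      subst this; exact absurd hodd (by decide)
    · exact h
  have hq : 3 * p^e ≤ p^(e+1) := by
    rw [pow_succ, mul_comm]; exact Nat.mul_le_mul_left _ hp3
  have hq' : (3:ℤ) * (p:ℤ)^e ≤ (p:ℤ)^(e+1) := by exact_mod_cast hq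
  have hr' : (r:ℤ) < (p:ℤ)^e := by exact_mod_cast hr
  have hs1' : (p:ℤ)^e ≤ s := by exact_mod_cast hs1
  have hs2' : (s:ℤ) < 2 * (p:ℤ)^e := by exact_mod_cast hs2
  have hpos : 0 < (p:ℤ)^e := by have := hp.out.pos; positivity
  refine avoid (al_irr p (k * p^(e+1) + r) hodd).cfInf hQ hP hQ0 (a := 2*m*(p:ℤ)^(e+1))
    (b := (2*m+1) * (p:ℤ)^(e+1) - r + 1) (by positivity) (hQV.resolve_left hQ0) hD i ?_ ?_
  · rw [hi]; push_cast; linarith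
  · rw [hi]; push_cast; linarith

lemma count_mul_eq (q : ℕ → Prop) (a P : ℕ) :
    Nat.count q (a * P) = ∑ v ∈ Finset.range a, Nat.count (fun M => q (v * P + M)) P := by
  induction a with
  | zero => simp
  | succ a ih => rw [Nat.succ_mul, Nat.count_add, ih, Finset.sum_range_succ]

lemma sum_mul_eq (g : ℕ → ℕ) (a P : ℕ) :
    ∑ i ∈ Finset.range (a * P), g i =
      ∑ u ∈ Finset.range a, ∑ r ∈ Finset.range P, g (u * P + r) := by
  induction a with
  | zero => simp
  | succ a ih => rw [Nat.succ_mul, Finset.sum_range_add, ih, Finset.sum_range_succ]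

/-- number of surviving pairs in an aligned square -/
def Unc (S : ℕ → ℕ → Prop) (P k n : ℕ) : ℕ :=
  ∑ r ∈ Finset.range P, Nat.count (fun M => S (k * P + r) (n * P + M)) P

lemma Unc_mul (S : ℕ → ℕ → Prop) (a P k n : ℕ) :
    Unc S (a * P) k n =
      ∑ u ∈ Finset.range a, ∑ v ∈ Finset.range a, Unc S P (k * a + u) (n * a + v) := by
  unfold Unc
  rw [sum_mul_eq]
  refine Finset.sum_congr rfl fun u _ => ?_
  rw [Finset.sum_comm]
  refine Finset.sum_congr rfl fun r _ => ?_
  rw [count_mul_eq]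
  refine Finset.sum_congr rfl fun v _ => ?_
  congr 1
  funext M
  congr 1 <;> ring

lemma Unc_le (p : ℕ) (hp : 2 ≤ p) (hodd : p % 2 = 1) (S : ℕ → ℕ → Prop)
    (H : ∀ e k n r s : ℕ, k % 2 = 1 → n % 2 = 0 → r < p^e → p^e ≤ s → s < 2 * p^e →
      ¬ S (k * (p^e * p) + r) (n * (p^e * p) + s)) (J k n : ℕ) :
    Unc S (p^(2*J)) k n ≤ (p^4 - 1)^J := by
  induction J generalizing k n with
  | zero =>
    simp only [Unc, mul_zero, pow_zero, Finset.sum_range_one]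
    exact Nat.count_le _
  | succ J ih =>
    have h1 : p^(2*(J+1)) = p^2 * p^(2*J) := by ring
    rw [h1, Unc_mul, ← Finset.sum_product' (Finset.range (p^2)) (Finset.range (p^2))
      (fun u v => Unc S (p^(2*J)) (k * p^2 + u) (n * p^2 + v))]
    have hpp : p * 1 + 1 < p^2 := by nlinarith
    obtain ⟨κ, hκ, hκ1⟩ : ∃ κ, (k + κ) % 2 = 1 ∧ κ ≤ 1 := ⟨(k+1)%2, by omega, by omega⟩
    obtain ⟨ν, hν, hν1⟩ : ∃ ν, (n + ν) % 2 = 0 ∧ ν ≤ 1 := ⟨n%2, by omega, by omega⟩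
    have hu : p * κ < p^2 := by nlinarith
    have hv : p * ν + 1 < p^2 := by nlinarith
    have hmem : (p * κ, p * ν + 1) ∈ Finset.range (p^2) ×ˢ Finset.range (p^2) := by
      simp [hu, hv]
    have hzero : Unc S (p^(2*J)) (k * p^2 + p * κ) (n * p^2 + (p * ν + 1)) = 0 := by
      unfold Unc
      apply Finset.sum_eq_zero
      intro r hr
      rw [Finset.mem_range] at hr
      rw [Nat.count_eq_card_filter_range, Finset.card_eq_zero, Finset.filter_eq_empty_iff]
      intro M hM
      rw [Finset.mem_range] at hM
      have e1 : (k * p + κ) % 2 = 1 := by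
        rw [Nat.add_mod, Nat.mul_mod, hodd, mul_one, Nat.mod_mod, ← Nat.add_mod]
        exact hκ
      have e2 : (n * p + ν) % 2 = 0 := by
        rw [Nat.add_mod, Nat.mul_mod, hodd, mul_one, Nat.mod_mod, ← Nat.add_mod]
        exact hν
      have := H (2*J) (k * p + κ) (n * p + ν) r (p^(2*J) + M) e1 e2 hr (by omega) (by omega)
      convert this using 2 <;> ring
    rw [← Finset.add_sum_erase _ _ hmem]
    simp only
    rw [hzero, zero_add]
    refine (Finset.sum_le_card_nsmul _ _ _ (fun x _ => ih _ _)).trans ?_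
    have h4 : p^2 * p^2 = p^4 := by ring
    rw [Finset.card_erase_of_mem hmem, Finset.card_product, Finset.card_range, smul_eq_mul, h4,
      pow_succ' (p^4-1) J]

lemma total_le (p : ℕ) (hp : 2 ≤ p) (hodd : p % 2 = 1) (S : ℕ → ℕ → Prop)
    (H : ∀ e k n r s : ℕ, k % 2 = 1 → n % 2 = 0 → r < p^e → p^e ≤ s → s < 2 * p^e →
      ¬ S (k * (p^e * p) + r) (n * (p^e * p) + s)) (J a : ℕ) :
    ∑ k ∈ Finset.range (p^(2*J)), Nat.count (S k) (a * p^(2*J)) ≤ a * (p^4 - 1)^J := by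
  simp only [count_mul_eq]
  rw [Finset.sum_comm]
  have h := Finset.sum_le_card_nsmul (Finset.range a)
    (fun n => Unc S (p^(2*J)) 0 n) ((p^4-1)^J) (fun n _ => Unc_le p hp hodd S H J 0 n)
  simpa [Unc] using h

section mass
variable {f : LaurentSeries K}

lemma count_ge (hf : CFInf f) (I X : ℕ) (h : cfN f I ≤ X) :
    I ≤ Nat.count (fun M : ℕ => ∃ i, cfN f i = M) X := by
  rw [Nat.count_eq_card_filter_range]
  have hm := cfN_strictMono hf
  have h0 : ∀ i, 0 ≤ cfN f i := fun i => by
    have := hm.monotone (Nat.zero_le i)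
    simpa [cfN] using this
  have := Finset.card_le_card_of_injOn (s := Finset.range I)
    (t := (Finset.range X).filter (fun M : ℕ => ∃ i, cfN f i = M)) (fun i => (cfN f i).toNat) ?_ ?_
  · simpa using this
  · intro i hi
    have hi' : i < I := by simpa using hi
    have h1 := hm hi'
    have h2 := h0 i
    simp only [Finset.coe_filter, Finset.mem_range, Set.mem_setOf_eq]
    exact ⟨by omega, i, by omega⟩
  · intro i _ j _ hij
    simp only at hij
    have := h0 i
    have := h0 j
    exact hm.injective (by omega)

lemma sum_window (f : LaurentSeries K) (m l : ℕ) :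
    ∑ i ∈ Finset.Ico (m+1) (m+1+l), (degZ (cfPQ f i) : ℝ) = ((cfN f (m+l) - cfN f m : ℤ) : ℝ) := by
  induction l with
  | zero => simp
  | succ l ih =>
    rw [← add_assoc, Finset.sum_Ico_succ_top (by omega), ih, ← add_assoc, cfN_succ]
    have : m + 1 + l = m + l + 1 := by omega
    rw [this]; push_cast; ring

lemma mass_bound (hf : CFInf f) (hw : ∃ s : ℕ × ℕ, PeriodWindow f s.1 s.2) (n : ℕ) {ε : ℝ}
    (hε : 0 < ε) (hb : eMassOf f n ≤ 1 - ε) :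
    ∃ C : ℝ, ∀ X : ℕ, ε * X ≤ n * (Nat.count (fun M : ℕ => ∃ i, cfN f i = M) X : ℝ) + C := by
  rw [eMassOf, dif_pos hw] at hb
  have hspec := Classical.choose_spec hw
  set m := (Classical.choose hw).1
  set l := (Classical.choose hw).2
  obtain ⟨hl, hper⟩ := hspec
  have hm := cfN_strictMono hf
  have hsum := sum_window f m l
  set L : ℤ := cfN f (m+l) - cfN f m with hL
  have hLpos : 0 < L := by
    have := hm (show m < m + l by omega)
    omega
  have hLr : (0:ℝ) < (L:ℝ) := by exact_mod_cast hLpos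
  have hlow : (L:ℝ) - n * l ≤ ∑ i ∈ Finset.Ico (m+1) (m+1+l), max ((degZ (cfPQ f i) : ℝ) - n) 0 := by
    have h1 : ∑ i ∈ Finset.Ico (m+1) (m+1+l), ((degZ (cfPQ f i) : ℝ) - n) = (L:ℝ) - n * l := by
      rw [Finset.sum_sub_distrib, hsum]; simp [mul_comm]
    rw [← h1]
    exact Finset.sum_le_sum fun i _ => le_max_left _ _
  rw [hsum, div_le_iff₀ hLr] at hb
  have hkey : ε * L ≤ n * l := by nlinarith
  have hNper : ∀ i, m ≤ i → cfN f (i + l) = cfN f i + L := by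
    intro i hi
    induction i, hi using Nat.le_induction with
    | base => omega
    | succ i hi ih =>
      have e : i + 1 + l = (i + l) + 1 := by omega
      have e2 := hper (i+1) (by omega)
      rw [e] at e2
      rw [e, cfN_succ, cfN_succ, ih, e2]; ring
  have hNj : ∀ j : ℕ, cfN f (m + j * l) = cfN f m + j * L := by
    intro j
    induction j with
    | zero => simp
    | succ j ih =>
      have e : m + (j+1) * l = m + j * l + l := by ring
      rw [e, hNper _ (by omega), ih]; push_cast; ring
  have hN0 : 0 ≤ cfN f m := by
    have := hm.monotone (Nat.zero_le m)
    simpa [cfN] using this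
  refine ⟨ε * (cfN f m + L), fun X => ?_⟩
  have hn0 : (0:ℝ) ≤ n := Nat.cast_nonneg n
  by_cases hX : (X:ℤ) < cfN f m
  · have h1 : (X:ℝ) ≤ (cfN f m : ℝ) := by exact_mod_cast hX.le
    have h2 : ε * X ≤ ε * (cfN f m + L) := by
      apply mul_le_mul_of_nonneg_left _ hε.le; linarith
    have : (0:ℝ) ≤ n * (Nat.count (fun M : ℕ => ∃ i, cfN f i = M) X : ℝ) := by positivity
    linarith
  · push Not at hX
    obtain ⟨j, hj⟩ := Int.eq_ofNat_of_zero_le (Int.ediv_nonneg (sub_nonneg.mpr hX) hLpos.le)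
    have h1 := Int.mul_ediv_add_emod ((X:ℤ) - cfN f m) L
    have h2 := Int.emod_nonneg ((X:ℤ) - cfN f m) hLpos.ne'
    have h3 := Int.emod_lt_of_pos ((X:ℤ) - cfN f m) hLpos
    rw [hj] at h1
    have h4 : cfN f m + j * L ≤ X := by nlinarith
    have h5 : (X:ℤ) < cfN f m + j * L + L := by nlinarith
    have h6 := count_ge hf (m + j * l) X (by rw [hNj]; exact h4)
    have h7 : ((m + j * l : ℕ) : ℝ) ≤ (Nat.count (fun M : ℕ => ∃ i, cfN f i = M) X : ℝ) := by
      exact_mod_cast h6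
    have h8 : (X:ℝ) ≤ cfN f m + j * L + L := by exact_mod_cast h5.le
    push_cast at h7
    have hm0 : (0:ℝ) ≤ m := Nat.cast_nonneg m
    have h9 : (n:ℝ) * (j * l) ≤ n * (Nat.count (fun M : ℕ => ∃ i, cfN f i = M) X : ℝ) :=
      mul_le_mul_of_nonneg_left (by linarith) hn0
    have h10 : ε * X ≤ ε * (cfN f m + j * L + L) := mul_le_mul_of_nonneg_left h8 hε.le
    have h11 : (j:ℝ) * (ε * L) ≤ j * (n * l) := mul_le_mul_of_nonneg_left hkey (Nat.cast_nonneg j)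
    linarith
end mass

lemma le_of_forall_nat {x y C : ℝ} (h : ∀ a : ℕ, a * x ≤ a * y + C) : x ≤ y := by
  by_contra hlt
  push Not at hlt
  obtain ⟨a, ha⟩ := exists_nat_gt (C / (x - y))
  rw [div_lt_iff₀ (by linarith)] at ha
  have := h a
  nlinarith

lemma bad_card (p : ℕ) [hp : Fact p.Prime] (hodd : Odd p) (n : ℕ) {ε : ℝ} (hε : 0 < ε) (J : ℕ) :
    (((Finset.range (p^(2*J))).filter fun k => eMassOf (al p k) n ≤ 1 - ε).card : ℝ) * ε * (p:ℝ)^(2*J)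
      ≤ n * ((p:ℝ)^4 - 1)^J := by
  set Bd := (Finset.range (p^(2*J))).filter fun k => eMassOf (al p k) n ≤ 1 - ε with hBd
  have h1 : ∀ k, ∃ C : ℝ, k ∈ Bd → ∀ X : ℕ, ε * X ≤ n * (Nat.count (SS p k) X : ℝ) + C := by
    intro k
    by_cases hk : k ∈ Bd
    · have hk2 := (Finset.mem_filter.mp hk).2
      have hirr := al_irr p k hodd
      obtain ⟨C, hC⟩ := mass_bound hirr.cfInf
        (exists_window hirr (pow_mem tLS_mem (2*k)) (al_sq p k hodd)) n hε hk2
      exact ⟨C, fun _ => hC⟩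
    · exact ⟨0, fun h => absurd h hk⟩
  choose C hC using h1
  have hp2 := hp.out.two_le
  have hn0 : (0:ℝ) ≤ n := Nat.cast_nonneg n
  apply le_of_forall_nat (C := ∑ k ∈ Bd, C k)
  intro a
  have h2 : ∑ k ∈ Bd, ε * ((a * p^(2*J) : ℕ) : ℝ) ≤
      ∑ k ∈ Bd, (n * (Nat.count (SS p k) (a * p^(2*J)) : ℝ) + C k) :=
    Finset.sum_le_sum fun k hk => hC k hk _
  rw [Finset.sum_const, Finset.sum_add_distrib, ← Finset.mul_sum, nsmul_eq_mul] at h2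
  have h3 : ∑ k ∈ Bd, (Nat.count (SS p k) (a * p^(2*J)) : ℝ) ≤ a * ((p:ℝ)^4-1)^J := by
    have h4 := total_le p hp2 (Nat.odd_iff.mp hodd) (SS p)
      (fun e k n r s h1 h2 h3 h4 h5 => SS_avoid p hodd e k n r s h1 h2 h3 h4 h5) J a
    have h5 : ∑ k ∈ Bd, Nat.count (SS p k) (a * p^(2*J)) ≤ a * (p^4-1)^J :=
      (Finset.sum_le_sum_of_subset (Finset.filter_subset _ _)).trans h4
    have h6 : ((p^4 - 1 : ℕ) : ℝ) = (p:ℝ)^4 - 1 := by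
      rw [Nat.cast_sub (Nat.one_le_pow _ _ (by omega))]; push_cast; rfl
    rw [← h6]
    exact_mod_cast h5
  have h7 := mul_le_mul_of_nonneg_left h3 hn0
  push_cast at h2
  nlinarith

lemma density_one (p : ℕ) [hp : Fact p.Prime] (hodd : Odd p) (n : ℕ) {ε : ℝ} (hε : 0 < ε) :
    HasDensity {k : ℕ | 1 - ε < eMass (cantorTheta p) k n} 1 := by
  have hp2 := hp.out.two_le
  have hpR : (2:ℝ) ≤ p := by exact_mod_cast hp2
  have hp0 : (0:ℝ) < p := by linarith
  have hp4 : (1:ℝ) ≤ (p:ℝ)^4 := one_le_pow₀ (by linarith)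
  set ρ : ℝ := ((p:ℝ)^4 - 1) / (p:ℝ)^4 with hρ
  have hρ0 : 0 ≤ ρ := div_nonneg (by linarith) (by linarith)
  have hρ1 : ρ < 1 := by rw [hρ, div_lt_one (by linarith)]; linarith
  set A := {k : ℕ | 1 - ε < eMass (cantorTheta p) k n} with hA
  let J : ℕ → ℕ := fun M => Nat.log (p^2) M + 1
  have hJ : Tendsto J atTop atTop := by
    rw [tendsto_atTop]
    intro b
    filter_upwards [eventually_ge_atTop ((p^2)^b)] with M hM
    have := Nat.le_log_of_pow_le (show 1 < p^2 by nlinarith) hM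
    simp only [J]; omega
  have hlim : Tendsto (fun M => 1 - (n / ε * (p:ℝ)^2) * ρ ^ (J M)) atTop (nhds 1) := by
    have h := ((tendsto_pow_atTop_nhds_zero_of_lt_one hρ0 hρ1).comp hJ).const_mul (n / ε * (p:ℝ)^2)
    have h2 := h.const_sub 1
    simpa using h2
  have hsplit : ∀ M : ℕ, (((Finset.Icc 1 M).filter fun k => k ∈ A).card : ℝ) +
      (((Finset.Icc 1 M).filter fun k => k ∉ A).card : ℝ) = M := by
    intro M
    have := Finset.card_filter_add_card_filter_not (s := Finset.Icc 1 M) (fun k => k ∈ A)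
    rw [Nat.card_Icc, Nat.add_sub_cancel] at this
    exact_mod_cast this
  unfold HasDensity
  refine tendsto_of_tendsto_of_tendsto_of_le_of_le' hlim tendsto_const_nhds ?_ ?_
  · filter_upwards [eventually_ge_atTop 1] with M hM
    have hM0 : (0:ℝ) < M := by exact_mod_cast hM
    have hM1 : M < p^(2 * J M) := by
      rw [pow_mul]; exact Nat.lt_pow_succ_log_self (by nlinarith) M
    have hM2 : p^(2 * J M) ≤ p^2 * M := by
      have := Nat.pow_log_le_self (p^2) (show M ≠ 0 by omega)
      rw [pow_mul]; simp only [J]; rw [pow_succ']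
      exact Nat.mul_le_mul_left _ this
    have hM2' : (p:ℝ)^(2 * J M) ≤ (p:ℝ)^2 * M := by exact_mod_cast hM2
    have hb := bad_card p hodd n hε (J M)
    set b : ℝ := (((Finset.Icc 1 M).filter fun k => k ∉ A).card : ℝ) with hbdef
    set b' : ℝ := (((Finset.range (p^(2*J M))).filter fun k => eMassOf (al p k) n ≤ 1 - ε).card : ℝ)
    have hbb : b ≤ b' := by
      have : ((Finset.Icc 1 M).filter fun k => k ∉ A) ⊆
          ((Finset.range (p^(2*J M))).filter fun k => eMassOf (al p k) n ≤ 1 - ε) := by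
        intro k hk
        rw [Finset.mem_filter, Finset.mem_Icc] at hk
        rw [Finset.mem_filter, Finset.mem_range]
        refine ⟨by omega, ?_⟩
        have h2 := hk.2
        simp only [hA, Set.mem_setOf_eq, not_lt] at h2
        exact h2
      exact (Nat.cast_le (α := ℝ)).mpr (Finset.card_le_card this)
    have hPpos : (0:ℝ) < (p:ℝ)^(2 * J M) := by positivity
    have hpow : ((p:ℝ)^4 - 1)^(J M) = ρ^(J M) * ((p:ℝ)^(2 * J M) * (p:ℝ)^(2 * J M)) := by
      rw [hρ, div_pow, ← pow_add, ← pow_mul]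
      have : 2 * J M + 2 * J M = 4 * J M := by ring
      rw [this, div_mul_cancel₀ _ (by positivity)]
    rw [hpow] at hb
    have hb2 : b' * ε ≤ n * ρ^(J M) * (p:ℝ)^(2 * J M) := by
      have : (b' * ε) * (p:ℝ)^(2 * J M) ≤ (n * ρ^(J M) * (p:ℝ)^(2 * J M)) * (p:ℝ)^(2 * J M) := by
        linarith
      exact le_of_mul_le_mul_right this hPpos
    have hb3 : b * ε ≤ n * ρ^(J M) * ((p:ℝ)^2 * M) := by
      refine (mul_le_mul_of_nonneg_right hbb hε.le).trans (hb2.trans ?_)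
      exact mul_le_mul_of_nonneg_left hM2' (by positivity)
    have hb4 : b ≤ (n / ε * (p:ℝ)^2) * ρ^(J M) * M := by
      have h5 : (n / ε * (p:ℝ)^2) * ρ^(J M) * M = (n * ρ^(J M) * ((p:ℝ)^2 * M)) / ε := by
        field_simp
      rw [h5, le_div_iff₀ hε]; exact hb3
    rw [le_div_iff₀ hM0]
    have := hsplit M
    nlinarith
  · filter_upwards [eventually_ge_atTop 1] with M hM
    have hM0 : (0:ℝ) < M := by exact_mod_cast hM
    rw [div_le_one hM0]
    have := hsplit M
    have h2 : (0:ℝ) ≤ (((Finset.Icc 1 M).filter fun k => k ∉ A).card : ℝ) := Nat.cast_nonneg _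
    linarith

/-- For every odd prime `p`, `Θ_p` exhibits full generic escape of mass
with respect to `{t^k}`. -/
theorem pCantor_full_generic_escape (p : ℕ) [Fact p.Prime] (hodd : Odd p) :
    FullGenericEscape (cantorTheta p) := by
  intro ε hε
  exact ⟨fun _ => 1, fun n => density_one p hodd n hε, tendsto_const_nhds⟩

end EscapeOfMass
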